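/- The function n ↦ n + ∑_{i=1}^{⌈log₂ n⌉} 2^i · ⌊n/(2^{i-1}+1)⌋ (with values cast to the reals, and ⌈log₂ n⌉ = Nat.clog 2 n) is O(n · log n) as n → ∞. -/

import Mathlib

open Asymptotics Filter

theorem two_pow_mul_div_two_pow_pred_add_one_le (n : ℕ) {i : ℕ} (hi : 1 ≤ i) :
    2 ^ i * (n / (2 ^ (i - 1) + 1)) ≤ 2 * n := by
  obtain ⟨k, rfl⟩ := Nat.exists_eq_add_of_le' hi
  rw [Nat.add_sub_cancel, pow_succ', mul_assoc]
  gcongr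
  calc 2 ^ k * (n / (2 ^ k + 1)) ≤ (2 ^ k + 1) * (n / (2 ^ k + 1)) := by gcongr; omega
    _ ≤ n := Nat.mul_div_le _ _

theorem sufficient_cover_size_le (n : ℕ) :
    n + ∑ i ∈ Finset.Icc 1 (Nat.clog 2 n), 2 ^ i * (n / (2 ^ (i - 1) + 1)) ≤
      n + Nat.clog 2 n * (2 * n) := by
  gcongr
  simpa using Finset.sum_le_card_nsmul (Finset.Icc 1 (Nat.clog 2 n)) _ (2 * n) fun i hi =>
    two_pow_mul_div_two_pow_pred_add_one_le n (Finset.mem_Icc.mp hi).1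

theorem half_le_log_natCast {n : ℕ} (hn : 2 ≤ n) : 1 / 2 ≤ Real.log n := by
  have h : Real.log 2 ≤ Real.log n := Real.log_le_log two_pos (by exact_mod_cast hn)
  linarith [Real.log_two_gt_d9]

theorem clog_two_le_four_mul_log {n : ℕ} (hn : 2 ≤ n) : (Nat.clog 2 n : ℝ) ≤ 4 * Real.log n := by
  have hpow : (2 : ℝ) ^ (Nat.clog 2 n - 1) ≤ n := by
    exact_mod_cast (Nat.pow_pred_clog_lt_self one_lt_two hn).le
  have hlog := Real.log_le_log (by positivity) hpow
  rw [Real.log_pow, Nat.cast_pred (Nat.clog_pos one_lt_two hn)] at hlog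
  have hclog : (1 : ℝ) ≤ Nat.clog 2 n := by exact_mod_cast Nat.clog_pos one_lt_two hn
  nlinarith [Real.log_two_gt_d9, half_le_log_natCast hn]

/-- The size of the sufficient cover is `O(n log n)` as `n → ∞`. -/
theorem sufficient_cover_size_isBigO :
    (fun n : ℕ =>
        ((n + ∑ i ∈ Finset.Icc 1 (Nat.clog 2 n), 2 ^ i * (n / (2 ^ (i - 1) + 1)) : ℕ) : ℝ))
      =O[atTop] fun n : ℕ => (n : ℝ) * Real.log n := by
  refine IsBigO.of_bound 10 ?_
  filter_upwards [eventually_ge_atTop 2] with n hn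
  have hlog := half_le_log_natCast hn
  rw [Real.norm_of_nonneg (by positivity), Real.norm_of_nonneg (by positivity)]
  calc ((n + ∑ i ∈ Finset.Icc 1 (Nat.clog 2 n), 2 ^ i * (n / (2 ^ (i - 1) + 1)) : ℕ) : ℝ)
      ≤ ((n + Nat.clog 2 n * (2 * n) : ℕ) : ℝ) := by exact_mod_cast sufficient_cover_size_le n
    _ = n * (1 + 2 * Nat.clog 2 n) := by push_cast; ring
    _ ≤ n * (10 * Real.log n) := by
      gcongr
      linarith [clog_two_le_four_mul_log hn]
    _ = 10 * (n * Real.log n) := by ring
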